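/- arXiv:1911.08574 — 2 statements merged into one kernel-verified Lean document; each statement's English description precedes it below -/
import Mathlib

section
/- Let M be an aperiodic monoid satisfying the identity xyx ≈ xᵖyx^q for some integers p ≥ 1 and q ≥ 2. Then M satisfies the identities x² ≈ x³ and xyx ≈ xyx². -/
open FreeMonoid

/-- Words over the countably infinite alphabet `ℕ`. -/
abbrev Word : Type := FreeMonoid ℕ

/-- The word corresponding to a list of letters. -/
def wd (l : List ℕ) : Word := FreeMonoid.ofList l

/-- A monoid `M` satisfies the identity `e.1 ≈ e.2`. -/
def MSat (M : Type*) [Monoid M] (e : Word × Word) : Prop :=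
  ∀ φ : Word →* M, φ e.1 = φ e.2

/-- A monoid `M` satisfies every identity of `S`. -/
def SatAll (M : Type*) [Monoid M] (S : Set (Word × Word)) : Prop :=
  ∀ e ∈ S, MSat M e

/-- The varieties `Mod S` and `Mod T` coincide (they have exactly the same members). -/
def VarEq.{u} (S T : Set (Word × Word)) : Prop :=
  ∀ (M : Type u) [Monoid M], SatAll M S ↔ SatAll M T

/-- The variety `Mod S` is finitely based. -/
def FinitelyBased.{u} (S : Set (Word × Word)) : Prop :=
  ∃ T : Finset (Word × Word), VarEq.{u} S (↑T)

/-- `G` is a subgroup (a subsemigroup which is a group) of the monoid `M`. -/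
def IsSubgroupIn (M : Type*) [Monoid M] (G : Set M) : Prop :=
  (∀ a ∈ G, ∀ b ∈ G, a * b ∈ G) ∧
    ∃ e ∈ G, (∀ g ∈ G, e * g = g ∧ g * e = g) ∧ ∀ g ∈ G, ∃ h ∈ G, g * h = e ∧ h * g = e

/-- A monoid is aperiodic if all its subgroups have exactly one element. -/
def AperiodicMonoid (M : Type*) [Monoid M] : Prop :=
  ∀ G : Set M, IsSubgroupIn M G → ∀ a ∈ G, ∀ b ∈ G, a = b

/-- The idempotents of `M` commute. -/
def CommIdem (M : Type*) [Monoid M] : Prop :=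
  ∀ e f : M, e * e = e → f * f = f → e * f = f * e

/-- `w` is a factor (contiguous subword) of some word of `W`. -/
def IsFactorIn (W : Set (List ℕ)) (w : List ℕ) : Prop := ∃ s ∈ W, w <:+: s

theorem IsFactorIn.left {W : Set (List ℕ)} {u v : List ℕ} (h : IsFactorIn W (u ++ v)) :
    IsFactorIn W u := by
  obtain ⟨s, hs, hf⟩ := h
  exact ⟨s, hs, (List.prefix_append u v).isInfix.trans hf⟩

theorem IsFactorIn.right {W : Set (List ℕ)} {u v : List ℕ} (h : IsFactorIn W (u ++ v)) :
    IsFactorIn W v := by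
  obtain ⟨s, hs, hf⟩ := h
  exact ⟨s, hs, (List.suffix_append u v).isInfix.trans hf⟩

/-- The Rees congruence on the free monoid identifying all non-factors of words of `W`. -/
def reesCon (W : Set (List ℕ)) : Con Word where
  r u v := u = v ∨ (¬ IsFactorIn W (toList u) ∧ ¬ IsFactorIn W (toList v))
  iseqv := ⟨fun _ => Or.inl rfl, fun h => by tauto, fun h₁ h₂ => by
    rcases h₁ with rfl | h₁ <;> rcases h₂ with rfl | h₂ <;> tauto⟩
  mul' := by
    rintro w x y z (rfl | ⟨hw, hx⟩) (rfl | ⟨hy, hz⟩)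
    · exact Or.inl rfl
    · refine Or.inr ⟨fun h => hy ?_, fun h => hz ?_⟩
      · rw [toList_mul] at h; exact h.right
      · rw [toList_mul] at h; exact h.right
    · refine Or.inr ⟨fun h => hw ?_, fun h => hx ?_⟩
      · rw [toList_mul] at h; exact h.left
      · rw [toList_mul] at h; exact h.left
    · refine Or.inr ⟨fun h => hw ?_, fun h => hx ?_⟩
      · rw [toList_mul] at h; exact h.left
      · rw [toList_mul] at h; exact h.left

/-- The Rees quotient `S(W)` of the free monoid over the ideal of all words that
are not factors of any word in `W`. -/
abbrev SMon (W : Set (List ℕ)) : Type := (reesCon W).Quotient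

/-- The equational theory of the monoid `N`; `Mod (Th N)` is the variety generated by `N`. -/
def Th (N : Type*) [Monoid N] : Set (Word × Word) := {e | MSat N e}

/-- The reverse of a word. -/
def revW (w : Word) : Word := ofList (toList w).reverse

/-- The set of identities defining the dual variety. -/
def dualSet (S : Set (Word × Word)) : Set (Word × Word) :=
  (fun e : Word × Word => (revW e.1, revW e.2)) '' S

/-- letters: x = 0, y = 1, z = 2, t = 3. -/
def Oset : Set (Word × Word) :=
  {(wd [0,0,1,1], wd [1,1,0,0]), (wd [0,2,0,1,0,3,1], wd [0,2,1,0,3,1])}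

def Kset : Set (Word × Word) :=
  {(wd [0,1,0], wd [0,1,0,0]), (wd [0,0,1,1], wd [1,1,0,0]), (wd [0,0,1], wd [0,0,1,0])}

def Qset : Set (Word × Word) :=
  {(wd [0,1,0], wd [0,1,0,0]), (wd [0,0,1,1], wd [1,1,0,0]), (wd [0,1,0], wd [0,0,1,0])}

def Eset : Set (Word × Word) :=
  {(wd [0,0,1,1], wd [1,1,0,0]), (wd [0,0], wd [0,0,0]), (wd [1,0,0], wd [0,1,0])}

def F0set : Set (Word × Word) :=
  {(wd [0,1,0], wd [0,1,0,0]), (wd [0,0,1,1], wd [1,1,0,0]),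
   (wd [0,1,2,0,1], wd [1,0,2,0,1]), (wd [0,0,1], wd [0,0,1,0])}

/-- The identity `x z_{π(1)}⋯z_{π(n)} x (t₁z₁)⋯(tₙzₙ) ≈ x² z_{π(1)}⋯z_{π(n)} (t₁z₁)⋯(tₙzₙ)`,
with letters `x = 0`, `zᵢ = 2i+1`, `tᵢ = 2i+2`. -/
def Jscheme (n : ℕ) (π : Equiv.Perm (Fin n)) : Word × Word :=
  (of 0 * ((List.finRange n).map fun i => of (2 * (π i : ℕ) + 1)).prod * of 0 *
      ((List.finRange n).map fun i => of (2 * (i : ℕ) + 2) * of (2 * (i : ℕ) + 1)).prod,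
   of 0 * of 0 * ((List.finRange n).map fun i => of (2 * (π i : ℕ) + 1)).prod *
      ((List.finRange n).map fun i => of (2 * (i : ℕ) + 2) * of (2 * (i : ℕ) + 1)).prod)

/-- The defining identities of the variety `J`. -/
def Jset : Set (Word × Word) :=
  {(wd [0,1,0], wd [0,1,0,0]), (wd [0,0,1,1], wd [1,1,0,0]),
   (wd [0,1,2,0,1], wd [1,0,2,0,1]), (wd [0,1,0,2,3,0], wd [0,1,0,2,0,3,0])} ∪
  {e | ∃ n : ℕ, 1 ≤ n ∧ ∃ π : Equiv.Perm (Fin n), e = Jscheme n π}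

/-- The set of letters occurring in a word. -/
def conL (w : List ℕ) : Set ℕ := {a | a ∈ w}

/-- The set of simple letters of a word. -/
def simpleSet (w : List ℕ) : Set ℕ := {a | w.count a = 1}

/-- The set of multiple letters of a word. -/
def mulSet (w : List ℕ) : Set ℕ := {a | 2 ≤ w.count a}

/-- The position of the `i`-th occurrence (`i ≥ 1`) of the letter `a` in `w`. -/
def nthOccIdx (w : List ℕ) (a : ℕ) (i : ℕ) : ℕ :=
  ((List.range w.length).filter fun j => w.getD j (a + 1) == a).getD (i - 1) w.length

/-- `h_i(w,a)`: the right-most divider (simple letter) of `w` preceding the `i`-th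
occurrence of `a` in `w`; `none` encodes the empty divider `t₀`. -/
def hdiv (w : List ℕ) (a : ℕ) (i : ℕ) : Option ℕ :=
  ((w.take (nthOccIdx w a i)).filter fun b => w.count b == 1).getLast?

/-- `t(w,a)`: the right-most divider of `w` preceding the last occurrence of `a` in `w`. -/
def tdiv (w : List ℕ) (a : ℕ) : Option ℕ := hdiv w a (w.count a)

/-- The word `b₀ t₁ b₁ t₂ b₂ ⋯ tₘ bₘ` built from blocks and dividers. -/
def assemble (b0 : List ℕ) (ps : List (ℕ × List ℕ)) : List ℕ :=
  b0 ++ (ps.map fun p => p.1 :: p.2).flatten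

/-- `t₀ b₀ t₁ b₁ ⋯ tₘ bₘ` is the decomposition of `w`: the `tᵢ` are the dividers
(simple letters) of `w` and the blocks `bᵢ` consist of multiple letters. -/
def IsDecomp (w b0 : List ℕ) (ps : List (ℕ × List ℕ)) : Prop :=
  w = assemble b0 ps ∧ (∀ p ∈ ps, w.count p.1 = 1) ∧
    (∀ a ∈ b0, 2 ≤ w.count a) ∧ ∀ p ∈ ps, ∀ a ∈ p.2, 2 ≤ w.count a

/-- The identity `u ≈ v` is well-balanced: `u` and `v` have the same dividers in the
same order and corresponding blocks have the same number of occurrences of each letter. -/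
def WellBalanced (u v : List ℕ) : Prop :=
  ∃ b0 ps c0 qs, IsDecomp u b0 ps ∧ IsDecomp v c0 qs ∧
    ps.map Prod.fst = qs.map Prod.fst ∧
    List.Forall₂ (fun b c : List ℕ => ∀ a, b.count a = c.count a)
      (b0 :: ps.map Prod.snd) (c0 :: qs.map Prod.snd)

/-- `∏_{i=a}^{b} tᵢ eᵢ` where `tᵢ = i+1`, `eᵢ = x = 0` for odd `i` and `eᵢ = y = 1`
for even `i`. -/
def prodTE (a b : ℕ) : Word :=
  ((List.range' a (b + 1 - a)).map fun i =>
    of (i + 1) * of (if i % 2 = 1 then 0 else 1)).prod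

def alphaId (n : ℕ) : Word × Word :=
  (wd [0,1] * prodTE 1 (n+1), wd [1,0] * prodTE 1 (n+1))

def betaId (n : ℕ) : Word × Word :=
  (wd [1,0,0] * prodTE 2 (n+1), wd [0,1,0] * prodTE 1 n)

def gammaId (n : ℕ) : Word × Word :=
  (wd [0,0,1] * prodTE 1 (n+1), wd [0,1,0] * prodTE 1 (n+1))

def gammaId' (n : ℕ) : Word × Word :=
  (wd [0,0,1] * prodTE 2 (n+1), wd [0,1,0] * prodTE 2 (n+1))

/-- The family `Φ` of identities from Lemma 3.5 (letters `x = 0`, `y = 1`, `t = 2`). -/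
def PhiSet : Set (Word × Word) :=
  {(wd [0,1,2,0,1], wd [1,0,2,0,1]), (wd [1,0,0,2,0,1], wd [0,1,0,2,0,1]),
   (wd [0,0,1,2,0,1], wd [0,1,0,2,0,1])} ∪
  {e | ∃ n : ℕ, 1 ≤ n ∧ (e = alphaId n ∨ e = betaId n ∨ e = gammaId n ∨ e = gammaId' n)}
/-- An aperiodic monoid satisfying `xyx ≈ xᵖyx^q` with `p ≥ 1` and `q ≥ 2`
satisfies `x² ≈ x³` and `xyx ≈ xyx²`. -/
theorem aperiodic_satisfies_xx_xxx (M : Type*) [Monoid M]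
    (hap : AperiodicMonoid M) (p q : ℕ) (hp : 1 ≤ p) (hq : 2 ≤ q)
    (h : MSat M (wd [0,1,0], wd (List.replicate p 0 ++ 1 :: List.replicate q 0))) :
    MSat M (wd [0,0], wd [0,0,0]) ∧ MSat M (wd [0,1,0], wd [0,1,0,0]) := by
  have key : ∀ x y : M, x * (y * x) = x ^ p * (y * x ^ q) := by
    intro x y
    have := h (FreeMonoid.lift fun n => if n = 0 then x else y)
    simpa [wd, FreeMonoid.lift_apply] using this
  have hsq : ∀ x : M, x ^ 2 = x ^ 3 := by
    intro x
    obtain ⟨d, hd⟩ : ∃ d, p + q = 2 + (d + 1) := ⟨p + q - 3, by omega⟩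
    have h1 : x ^ 2 = x ^ (2 + (d + 1)) := by
      have := key x 1
      rw [one_mul, one_mul, ← pow_add, hd] at this
      rw [← this, pow_two]
    have h2 : ∀ n k, 2 ≤ k → x ^ (k + (d + 1) * n) = x ^ k := by
      intro n
      induction n with
      | zero => intro k _; simp
      | succ n ih =>
        intro k hk
        obtain ⟨j, rfl⟩ := Nat.exists_eq_add_of_le hk
        have e : 2 + j + (d + 1) * (n + 1) = (2 + (d + 1)) + (j + (d + 1) * n) := by ring
        rw [e, pow_add, ← h1, ← pow_add, ← add_assoc, ih _ hk]
    refine hap {a | ∃ k, 2 ≤ k ∧ a = x ^ k} ⟨?_, x ^ (2 * (d + 1)), ⟨_, by omega, rfl⟩, ?_, ?_⟩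
      _ ⟨2, le_rfl, rfl⟩ _ ⟨3, by omega, rfl⟩
    · rintro _ ⟨k, hk, rfl⟩ _ ⟨l, hl, rfl⟩
      exact ⟨k + l, by omega, (pow_add _ _ _).symm⟩
    · rintro _ ⟨k, hk, rfl⟩
      have : x ^ (k + 2 * (d + 1)) = x ^ k := by rw [mul_comm, h2 _ _ hk]
      exact ⟨by rw [← pow_add, add_comm, this], by rw [← pow_add, this]⟩
    · rintro _ ⟨k, hk, rfl⟩
      have : x ^ (k + (k * d + 2 * (d + 1))) = x ^ (2 * (d + 1)) := by
        have e : k + (k * d + 2 * (d + 1)) = 2 * (d + 1) + (d + 1) * k := by ring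
        rw [e, h2 _ _ (by omega)]
      exact ⟨_, ⟨k * d + 2 * (d + 1), by nlinarith [Nat.zero_le (k * d)], rfl⟩,
        by rw [← pow_add, this], by rw [← pow_add, add_comm, this]⟩
  constructor
  · intro φ
    have := hsq (φ (FreeMonoid.of 0))
    rw [← map_pow, ← map_pow] at this
    exact this
  · intro φ
    have hx : ∀ x y : M, x * (y * x) = x * (y * x) * x := by
      intro x y
      obtain ⟨j, rfl⟩ := Nat.exists_eq_add_of_le hq
      have e : x ^ (2 + j) = x ^ (2 + j) * x := by
        rw [← pow_succ, pow_add, hsq x, ← pow_add]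
        congr 1
        omega
      rw [key x y, mul_assoc, mul_assoc, ← e]
    have := hx (φ (FreeMonoid.of 0)) (φ (FreeMonoid.of 1))
    simp only [← map_mul] at this
    exact this
end

section
/- Let M be a monoid satisfying the identity xyx ≈ xyx² and, for some n ∈ ℕ, the identity xⁿyⁿ ≈ yⁿxⁿ. Then M satisfies the identity x²y² ≈ y²x². -/
open FreeMonoid

/-- A monoid satisfying `xyx ≈ xyx²` and `xⁿyⁿ ≈ yⁿxⁿ` for some `n ∈ ℕ`
satisfies `x²y² ≈ y²x²`. -/
theorem xxyy_commute (M : Type*) [Monoid M]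
    (h1 : MSat M (wd [0,1,0], wd [0,1,0,0]))
    (n : ℕ) (hn : 1 ≤ n)
    (h2 : MSat M (wd (List.replicate n 0 ++ List.replicate n 1),
                  wd (List.replicate n 1 ++ List.replicate n 0))) :
    MSat M (wd [0,0,1,1], wd [1,1,0,0]) := by
  have ev : ∀ (φ : Word →* M) (l : List ℕ),
      φ (wd l) = (l.map fun i => φ (FreeMonoid.of i)).prod := by
    intro φ l
    induction l with
    | nil => exact map_one φ
    | cons a l ih =>
      have h : wd (a :: l) = FreeMonoid.of a * wd l := rfl
      rw [h, map_mul, ih, List.map_cons, List.prod_cons]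
  have cube : ∀ a : M, a ^ 3 = a ^ 2 := by
    intro a
    have h := h1 (FreeMonoid.lift fun i => if i = 0 then a else 1)
    simp only [ev] at h
    simp at h
    rw [pow_succ, pow_two, mul_assoc]
    exact h.symm
  have pow_ge : ∀ (a : M) (k : ℕ), a ^ (k + 2) = a ^ 2 := by
    intro a k
    induction k with
    | zero => rfl
    | succ k ih => rw [show k + 1 + 2 = (k + 2) + 1 by ring, pow_succ, ih, ← pow_succ, cube]
  intro φ
  have h := h2 φ
  simp only [ev] at h ⊢
  simp only [List.map_append, List.map_replicate, List.prod_append, List.prod_replicate] at h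
  simp only [List.map_cons, List.map_nil, List.prod_cons, List.prod_nil, mul_one]
  generalize φ (FreeMonoid.of 0) = a at h ⊢
  generalize φ (FreeMonoid.of 1) = b at h ⊢
  have key : a ^ 2 * b ^ 2 = b ^ 2 * a ^ 2 := by
    obtain rfl | ⟨k, rfl⟩ : n = 1 ∨ ∃ k, n = k + 2 := by
      rcases n with _ | _ | k
      · omega
      · exact Or.inl rfl
      · exact Or.inr ⟨k, rfl⟩
    · have hc : Commute a b := by
        rw [pow_one, pow_one] at h
        exact h
      exact hc.pow_pow 2 2
    · simpa only [pow_ge] using h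
  simpa only [pow_two, mul_assoc] using key
end
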